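/- Let R be a perfect field with algebraic closure R̄, let G be a group, and let ρ : G → GL_N(R) be a group homomorphism whose associated module is simple, i.e. the only R-subspaces of R^N stable under all ρ(g) are 0 and R^N. Let D = {M ∈ M_N(R) : M·ρ(g) = ρ(g)·M for all g ∈ G} be the commutant (a finite-dimensional division R-algebra), let E be the center of D, let n = dim_R E, and let m be the integer with m² = dim_E D. Then N = m·n·d for some d ≥ 1, and there exist group homomorphisms τ₁, …, τ_n : G → GL_d(R̄), pairwise non-conjugate in GL_d(R̄) and each absolutely irreducible, together with P ∈ GL_N(R̄), such that for every g ∈ G the matrix P·ρ(g)·P⁻¹ is block diagonal with blocks τ₁(g), …, τ_n(g), each block repeated m times. Moreover the Galois group Gal(R̄/R) permutes the conjugacy classes of τ₁, …, τ_n simply transitively: for every σ ∈ Gal(R̄/R) and every k there is a unique k' such that τ_k^σ is conjugate to τ_{k'} in GL_d(R̄), and for every pair (k, k') some σ ∈ Gal(R̄/R) sends the class of τ_k to that of τ_{k'}. -/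

import Mathlib

set_option synthInstance.maxHeartbeats 1000000
set_option maxHeartbeats 2000000

/-- The commutant of a matrix representation `ρ : G → GL_N(R)`: the `R`-subalgebra of
`M_N(R)` of matrices commuting with every `ρ(g)`. -/
def repCommutant (R : Type*) [Field R] (G : Type*) [Group G] (N : ℕ)
    (ρ : G →* (Matrix (Fin N) (Fin N) R)ˣ) : Subalgebra R (Matrix (Fin N) (Fin N) R) :=
  Subalgebra.centralizer R {M | ∃ g : G, (ρ g).val = M}

section

open Module TensorProduct
open scoped Matrix

/-- A module over a matrix algebra is a sum of copies of the standard module. -/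
theorem exists_linearEquiv_blockDiagonal_of_matrix_algHom {K : Type*} [Field K] {d m q : ℕ}
    (hd : 0 < d) (hq : q = m * d)
    (φ : Matrix (Fin d) (Fin d) K →ₐ[K] Matrix (Fin q) (Fin q) K) :
    ∃ L : (Fin q → K) ≃ₗ[K] (Fin d × Fin m → K), ∀ M v,
      L (φ M *ᵥ v) = Matrix.blockDiagonal (fun _ : Fin m => M) *ᵥ L v := by
  open Matrix in
  classical
  let o : Fin d := ⟨0, hd⟩
  let W := LinearMap.range (Matrix.toLin' (φ (single o o 1)))
  let w := Module.finBasis K W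
  let r := finrank K W
  have hw (k) : φ (single o o 1) *ᵥ (w k : Fin q → K) = w k := by
    obtain ⟨u, hu⟩ := (w k).2
    rw [← hu, toLin'_apply, mulVec_mulVec, ← map_mul, single_mul_single_same, one_mul]
  let f : Fin d × Fin r → (Fin q → K) := fun p => φ (single p.1 o 1) *ᵥ (w p.2 : Fin q → K)
  have hli : LinearIndependent K f := by
    rw [Fintype.linearIndependent_iff]
    intro c hc p
    have h1 : ∑ k, c (p.1, k) • w k = 0 := by
      apply Subtype.ext
      have := congrArg (fun v => φ (single o p.1 1) *ᵥ v) hc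
      simp only [mulVec_zero, f, mulVec_sum, mulVec_smul, mulVec_mulVec, ← map_mul,
        Fintype.sum_prod_type] at this
      rw [Finset.sum_eq_single p.1] at this
      · simpa [hw] using this
      · intro j _ hj
        simp [single_mul_single_of_ne _ _ _ _ hj.symm]
      · simp
    exact Fintype.linearIndependent_iff.1 w.linearIndependent _ h1 p.2
  have hspan : ⊤ ≤ Submodule.span K (Set.range f) := by
    intro v _
    have h1 : v = ∑ i, φ (single i o 1) *ᵥ (φ (single o i 1) *ᵥ v) := by
      simp only [mulVec_mulVec, ← map_mul, single_mul_single_same, one_mul]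
      rw [← sum_mulVec, ← map_sum, sum_single_one, map_one, one_mulVec]
    rw [h1]
    refine Submodule.sum_mem _ fun i _ => ?_
    have hmem : φ (single o i 1) *ᵥ v ∈ W := by
      refine ⟨φ (single o i 1) *ᵥ v, ?_⟩
      rw [toLin'_apply, mulVec_mulVec, ← map_mul, single_mul_single_same, one_mul]
    have h2 := congrArg Subtype.val (w.sum_repr ⟨_, hmem⟩)
    simp only [Submodule.coe_sum, Submodule.coe_smul] at h2
    rw [← h2, mulVec_sum]
    refine Submodule.sum_mem _ fun k _ => ?_
    rw [mulVec_smul]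
    exact Submodule.smul_mem _ _ (Submodule.subset_span ⟨(i, k), rfl⟩)
  let β := Basis.mk hli hspan
  have hr : r = m := by
    have := Module.finrank_eq_card_basis β
    simp only [finrank_fin_fun, Fintype.card_prod, Fintype.card_fin] at this
    rw [hq, mul_comm] at this
    exact (Nat.eq_of_mul_eq_mul_left hd this).symm
  obtain rfl : r = m := hr
  refine ⟨β.equivFun, fun M v => ?_⟩
  have key : ∀ c : Fin d × Fin r → K, φ M *ᵥ (β.equivFun.symm c) =
      β.equivFun.symm (blockDiagonal (fun _ : Fin r => M) *ᵥ c) := by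
    intro c
    have hM (i : Fin d) : M * single i o 1 = ∑ j, M j i • single j o 1 := by
      ext a b
      simp [Matrix.mul_apply, Matrix.sum_apply, single_apply]
      by_cases h : o = b <;> simp [h]
    simp only [Basis.equivFun_symm_apply, β, Basis.mk_apply, f, mulVec_sum, mulVec_smul,
      mulVec_mulVec, ← map_mul, hM, map_sum, map_smul, sum_mulVec, smul_mulVec]
    simp only [Fintype.sum_prod_type, mulVec, dotProduct, blockDiagonal_apply, Finset.smul_sum,
      Finset.sum_smul]
    simp only [ite_mul, zero_mul, ite_smul, zero_smul, Finset.sum_ite_eq, Finset.mem_univ, if_true]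
    conv_lhs => enter [2, x]; rw [Finset.sum_comm]
    rw [Finset.sum_comm]
    refine Finset.sum_congr rfl fun j _ => ?_
    rw [Finset.sum_comm]
    refine Finset.sum_congr rfl fun k _ => Finset.sum_congr rfl fun i _ => ?_
    rw [smul_smul, mul_comm]
  rw [← β.equivFun.symm.injective.eq_iff, ← key]
  simp


attribute [local instance] TensorProduct.Algebra.module in
/-- Every endomorphism of the vector space underlying a central simple algebra is a sum of
two-sided multiplications. -/
theorem exists_eq_moduleAux_of_isCentral {E B : Type*} [Field E] [Ring B] [Algebra E B]
    [Algebra.IsCentral E B] [IsSimpleRing B] [FiniteDimensional E B] (f : Module.End E B) :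
    ∃ t : B ⊗[E] Bᵐᵒᵖ, f = TensorProduct.Algebra.moduleAux t := by
  classical
  have hmul (b c : B) (x : B) : (b ⊗ₜ[E] MulOpposite.op c) • x = b * x * c := by
    rw [TensorProduct.Algebra.smul_def]
    simp [mul_assoc]
  have : IsSimpleModule (B ⊗[E] Bᵐᵒᵖ) B := by
    rw [isSimpleModule_iff_toSpanSingleton_surjective]
    refine ⟨inferInstance, fun x hx => ?_⟩
    let S := LinearMap.range (LinearMap.toSpanSingleton (B ⊗[E] Bᵐᵒᵖ) B x)
    have hS (b c y : B) (hy : y ∈ S) : b * y * c ∈ S := by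
      rw [← hmul]
      exact S.smul_mem _ hy
    let I : TwoSidedIdeal B := TwoSidedIdeal.mk' S S.zero_mem S.add_mem S.neg_mem
      (fun {b y} hy => by simpa using hS b 1 y hy) (fun {y c} hy => by simpa using hS 1 c y hy)
    have hxS : x ∈ S := ⟨1, one_smul _ x⟩
    have h1 : (1 : B) ∈ I :=
      IsSimpleRing.one_mem_of_ne_zero_mem I hx ((TwoSidedIdeal.mem_mk' ..).2 hxS)
    have h1S : (1 : B) ∈ S := (TwoSidedIdeal.mem_mk' ..).1 h1
    intro y
    simpa using! hS y 1 1 h1S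
  have hEnd (g : Module.End (B ⊗[E] Bᵐᵒᵖ) B) : ∃ e : E, ∀ x, g x = e • x := by
    have h1 (x : B) : g x = x * g 1 := by
      have := g.map_smul (x ⊗ₜ[E] MulOpposite.op 1) 1
      rwa [hmul, hmul, mul_one, mul_one, mul_one] at this
    have h2 (x : B) : g x = g 1 * x := by
      have := g.map_smul (1 ⊗ₜ[E] MulOpposite.op x) 1
      rwa [hmul, hmul, one_mul, one_mul, one_mul] at this
    have h3 : g 1 ∈ Subalgebra.center E B :=
      Subalgebra.mem_center_iff.2 fun x => (h1 x).symm.trans (h2 x)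
    obtain ⟨e, he⟩ := Algebra.mem_bot.1 (Algebra.IsCentral.out h3)
    exact ⟨e, fun x => by rw [h2, ← he, Algebra.smul_def]⟩
  let f' : Module.End (Module.End (B ⊗[E] Bᵐᵒᵖ) B) B :=
    { f with
      map_smul' := fun g x => by
        obtain ⟨e, he⟩ := hEnd g
        simp [he] }
  obtain ⟨t, ht⟩ := jacobson_density f' (Finset.univ.image (finBasis E B))
  exact ⟨t, (finBasis E B).ext fun i => ht _ (by simp)⟩

/-- The base change of a central simple algebra along a field extension is simple. -/
theorem isSimpleRing_tensorProduct_of_isCentral (E K B : Type*) [Field E] [Field K] [Algebra E K]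
    [Ring B] [Algebra E B] [Algebra.IsCentral E B] [IsSimpleRing B] [FiniteDimensional E B] :
    IsSimpleRing (K ⊗[E] B) := by
  classical
  have hstable (I : TwoSidedIdeal (K ⊗[E] B)) (f : Module.End E B) (x) (hx : x ∈ I) :
      f.baseChange K x ∈ I := by
    obtain ⟨t, rfl⟩ := exists_eq_moduleAux_of_isCentral f
    induction t using TensorProduct.induction_on with
    | zero => simp [I.zero_mem]
    | tmul b c =>
      have (x : K ⊗[E] B) :
          (TensorProduct.Algebra.moduleAux (b ⊗ₜ[E] c)).baseChange K x =
            (1 ⊗ₜ b) * x * (1 ⊗ₜ c.unop) := by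
        induction x using TensorProduct.induction_on with
        | zero => simp
        | tmul k y => simp [TensorProduct.Algebra.moduleAux_apply, MulOpposite.smul_eq_mul_unop,
            mul_assoc]
        | add y z hy hz => rw [map_add, hy, hz, mul_add, add_mul]
      rw [this]
      exact I.mul_mem_right _ _ (I.mul_mem_left _ _ hx)
    | add t u ht hu =>
      rw [map_add, LinearMap.baseChange_add]
      exact I.add_mem ht hu
  refine ⟨⟨fun I => ?_⟩⟩
  rw [or_iff_not_imp_left]
  intro hI
  obtain ⟨x, hx, hx0⟩ : ∃ x ∈ I, x ≠ 0 := by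
    by_contra! h
    exact hI (TwoSidedIdeal.ext fun x => ⟨fun hx => by simpa using h x hx, fun hx => by
      rw [(by simpa using hx : x = 0)]; exact I.zero_mem⟩)
  let a := finBasis E B
  let A := Algebra.TensorProduct.basis K a
  obtain ⟨j, hj⟩ : ∃ j, A.repr x j ≠ 0 := by
    by_contra! h
    exact hx0 (A.repr.map_eq_zero_iff.1 (Finsupp.ext h))
  let f : Module.End E B := a.constr E (fun i => if i = j then 1 else 0)
  have hf : f.baseChange K x = A.repr x j • (1 : K ⊗[E] B) := by
    conv_lhs => rw [← A.sum_repr x]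
    simp only [A, f, map_sum, map_smul, Algebra.TensorProduct.basis_apply,
      LinearMap.baseChange_tmul, Basis.constr_basis, Algebra.TensorProduct.one_def]
    rw [Finset.sum_eq_single j] <;> simp +contextual
  have h1 : (1 : K ⊗[E] B) ∈ I := by
    have := I.mul_mem_left ((A.repr x j)⁻¹ • 1) _ (hstable I f x hx)
    rw [hf] at this
    simpa [hj] using this
  exact TwoSidedIdeal.ext fun y => ⟨fun _ => trivial, fun _ => by
    simpa using I.mul_mem_left y 1 h1⟩

/-- A central simple algebra of dimension `d ^ 2` over `E` has, for every embedding `ι` of `E` into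
an algebraically closed field, an absolutely irreducible `d`-dimensional representation extending
`ι`, and every representation extending `ι` is a sum of copies of it. -/
theorem exists_absolutelyIrreducible_extending {E K B : Type*} [Field E] [Field K] [IsAlgClosed K]
    [Ring B] [Algebra E B] [Algebra.IsCentral E B] [IsSimpleRing B] [FiniteDimensional E B]
    {d : ℕ} (hd : finrank E B = d ^ 2) (ι : E →+* K) :
    ∃ τ : B →+* Matrix (Fin d) (Fin d) K,
      (∀ e, τ (algebraMap E B e) = Matrix.scalar (Fin d) (ι e)) ∧
      Submodule.span K (Set.range τ) = ⊤ ∧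
      ∀ (m q : ℕ), q = m * d → ∀ ψ : B →+* Matrix (Fin q) (Fin q) K,
        (∀ e, ψ (algebraMap E B e) = Matrix.scalar (Fin q) (ι e)) →
        ∃ L : (Fin q → K) ≃ₗ[K] (Fin d × Fin m → K), ∀ b v,
          L (ψ b *ᵥ v) = Matrix.blockDiagonal (fun _ : Fin m => τ b) *ᵥ L v := by
  let : Algebra E K := ι.toAlgebra
  have := isSimpleRing_tensorProduct_of_isCentral E K B
  obtain ⟨d', _, ⟨φ⟩⟩ := IsSimpleRing.exists_algEquiv_matrix_of_isAlgClosed K (K ⊗[E] B)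
  have hd' : d' = d := by
    have h := φ.toLinearEquiv.finrank_eq
    rw [finrank_baseChange, hd, finrank_matrix] at h
    simp only [Fintype.card_fin, finrank_self, mul_one] at h
    nlinarith
  subst hd'
  have hd0 : 0 < d' := Nat.pos_of_neZero d'
  refine ⟨φ.toRingEquiv.toRingHom.comp
    (Algebra.TensorProduct.includeRight : B →ₐ[E] K ⊗[E] B).toRingHom, fun e => ?_, ?_,
    fun m q hq ψ hψ => ?_⟩
  · have : (1 : K) ⊗ₜ[E] algebraMap E B e = algebraMap K (K ⊗[E] B) (ι e) := by
      rw [Algebra.algebraMap_eq_smul_one, TensorProduct.tmul_smul, Algebra.algebraMap_eq_smul_one,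
        Algebra.TensorProduct.one_def, TensorProduct.smul_tmul', TensorProduct.smul_tmul',
        Algebra.smul_def, smul_eq_mul]
      rfl
    exact (congrArg φ this).trans (φ.commutes _)
  · rw [eq_top_iff]
    rintro M -
    obtain ⟨x, rfl⟩ := φ.surjective M
    induction x using TensorProduct.induction_on with
    | zero => simp
    | tmul k b =>
      have : k ⊗ₜ[E] b = k • ((1 : K) ⊗ₜ[E] b) := by simp [TensorProduct.smul_tmul']
      rw [this, map_smul]
      exact Submodule.smul_mem _ _ (Submodule.subset_span ⟨b, rfl⟩)
    | add x y hx hy => rw [map_add]; exact add_mem hx hy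
  · let ψ' : B →ₐ[E] Matrix (Fin q) (Fin q) K :=
      { ψ with
        commutes' := fun e => by
          simp [hψ]; rfl }
    let Ψ : K ⊗[E] B →ₐ[K] Matrix (Fin q) (Fin q) K :=
      Algebra.TensorProduct.lift (Algebra.ofId K _) ψ'
        (fun k b => Algebra.commute_algebraMap_left k (ψ' b))
    obtain ⟨L, hL⟩ := exists_linearEquiv_blockDiagonal_of_matrix_algHom hd0 hq
      (Ψ.comp φ.symm.toAlgHom)
    refine ⟨L, fun b v => ?_⟩
    have := hL (φ (1 ⊗ₜ b)) v
    have hΨ : (Ψ.comp φ.symm.toAlgHom) (φ (1 ⊗ₜ b)) = ψ b := by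
      have h1 : Ψ (1 ⊗ₜ b) = ψ b :=
        (Algebra.TensorProduct.lift_tmul _ _ _ _ _).trans (by rw [map_one, one_mul]; rfl)
      exact (congrArg Ψ (φ.symm_apply_apply _)).trans h1
    rw [hΨ] at this
    exact this

theorem isSimpleRing_end_of_divisionRing (D V : Type*) [DivisionRing D] [AddCommGroup V]
    [Module D V] [Module.Finite D V] [Nontrivial V] : IsSimpleRing (Module.End D V) := by
  have b := finBasis D V
  have : NeZero (finrank D V) := ⟨finrank_pos.ne'⟩
  have e : Module.End D V ≃+* Matrix (Fin (finrank D V)) (Fin (finrank D V)) Dᵐᵒᵖ :=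
    (b.equivFun.conjRingEquiv.trans (endVecRingEquivMatrixEnd _ D D)).trans
      (RingEquiv.moduleEndSelf D).symm.mapMatrix
  exact IsSimpleRing.of_ringEquiv e.symm inferInstance

theorem finrank_end_of_divisionRing (E D V : Type*) [Field E] [DivisionRing D] [Algebra E D]
    [FiniteDimensional E D] [AddCommGroup V] [Module D V] [Module E V] [IsScalarTower E D V]
    [Module.Finite D V] :
    finrank E V = finrank D V * finrank E D ∧
    finrank E (Module.End D V) = finrank D V ^ 2 * finrank E D := by
  have h : finrank E V = finrank D V * finrank E D := by
    rw [mul_comm, finrank_mul_finrank]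
  have : Module.Finite E V := Module.Finite.trans D V
  refine ⟨h, ?_⟩
  rw [← ((finBasis D V).constr E (M' := V)).finrank_eq, finrank_pi_fintype]
  simp [h]
  ring

/-- A linear isomorphism intertwining two families of matrices yields an invertible matrix
conjugating one into the other. -/
theorem exists_units_conj_of_linearEquiv {K B : Type*} [Field K] {d : ℕ}
    {X Y : B → Matrix (Fin d) (Fin d) K} (L : (Fin d → K) ≃ₗ[K] (Fin d × Fin 1 → K))
    (hL : ∀ b v, L (X b *ᵥ v) = Matrix.blockDiagonal (fun _ : Fin 1 => Y b) *ᵥ L v) :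
    ∃ Q : (Matrix (Fin d) (Fin d) K)ˣ, ∀ b, X b = Q.val * Y b * (Q⁻¹).val := by
  let L' : (Fin d → K) ≃ₗ[K] (Fin d → K) :=
    L.trans (LinearEquiv.funCongrLeft K K (Equiv.prodUnique (Fin d) (Fin 1)).symm)
  have hL' (b v) : L' (X b *ᵥ v) = Y b *ᵥ L' v := by
    ext i
    simp [L', hL, LinearMap.funLeft, Matrix.mulVec, dotProduct, Fintype.sum_prod_type,
      Matrix.blockDiagonal_apply]
  let Q : (Matrix (Fin d) (Fin d) K)ˣ :=
    ⟨LinearMap.toMatrix' L'.symm.toLinearMap, LinearMap.toMatrix' L'.toLinearMap,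
      by rw [← LinearMap.toMatrix'_comp]; simp, by rw [← LinearMap.toMatrix'_comp]; simp⟩
  refine ⟨Q, fun b => ?_⟩
  rw [Units.eq_mul_inv_iff_mul_eq]
  apply Matrix.toLin'.injective
  refine LinearMap.ext fun v => ?_
  obtain ⟨u, rfl⟩ := L'.surjective v
  have hQ (w : Fin d → K) : Q.val *ᵥ w = L'.symm w := by
    simp [Q, ← Matrix.toLin'_apply]
  simp only [Matrix.toLin'_apply, ← Matrix.mulVec_mulVec, hQ, ← hL', LinearEquiv.symm_apply_apply]

section

variable {R K E B : Type*} [Field R] [Field K] [Field E] [Algebra R K] [Algebra R E] [Ring B]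
  [Algebra R B] [Algebra E B] [IsScalarTower R E B]

/-- A ring homomorphism extending an `R`-linear embedding of `E` is `R`-linear. -/
theorem map_smul_of_extends_embedding {d : ℕ} {ι : E →ₐ[R] K} {t : B →+* Matrix (Fin d) (Fin d) K}
    (ht : ∀ e, t (algebraMap E B e) = Matrix.scalar (Fin d) (ι e)) (c : R) (b : B) :
    t (c • b) = algebraMap R K c • t b := by
  rw [Algebra.smul_def, map_mul, IsScalarTower.algebraMap_apply R E B, ht, ι.commutes,
    Matrix.smul_eq_diagonal_mul]
  rfl

/-- Conjugate representations extend the same embedding of `E`. -/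
theorem embedding_eq_of_conj {G : Type*} {r : G → B} (hr : Submodule.span R (Set.range r) = ⊤)
    {d : ℕ} (hd : 0 < d) {ι ι' : E →ₐ[R] K} {t t' : B →+* Matrix (Fin d) (Fin d) K}
    (ht : ∀ e, t (algebraMap E B e) = Matrix.scalar (Fin d) (ι e))
    (ht' : ∀ e, t' (algebraMap E B e) = Matrix.scalar (Fin d) (ι' e))
    (Q : (Matrix (Fin d) (Fin d) K)ˣ) (hQ : ∀ g, t (r g) = Q.val * t' (r g) * (Q⁻¹).val) :
    ι = ι' := by
  have hB (b : B) : t b = Q.val * t' b * (Q⁻¹).val := by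
    have hb : b ∈ Submodule.span R (Set.range r) := hr ▸ trivial
    induction hb using Submodule.span_induction with
    | mem x hx => obtain ⟨g, rfl⟩ := hx; exact hQ g
    | zero => simp
    | add x y _ _ hx hy => simp [hx, hy, mul_add, add_mul]
    | smul c x _ hx =>
      rw [map_smul_of_extends_embedding ht, map_smul_of_extends_embedding ht', hx]
      simp
  ext e
  have h := hB (algebraMap E B e)
  rw [ht, ht', ← (Matrix.scalar_commute (ι' e) (fun _ => Commute.all _ _) Q.val).eq,
    mul_assoc, Units.mul_inv, mul_one] at h
  simpa using congrFun₂ h ⟨0, hd⟩ ⟨0, hd⟩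

/-- The span of a representation of the algebra is already the span of its values on a spanning
set. -/
theorem span_range_comp_eq_top {G : Type*} {r : G → B} (hr : Submodule.span R (Set.range r) = ⊤)
    {d : ℕ} {ι : E →ₐ[R] K} {t : B →+* Matrix (Fin d) (Fin d) K}
    (ht : ∀ e, t (algebraMap E B e) = Matrix.scalar (Fin d) (ι e))
    (hspan : Submodule.span K (Set.range t) = ⊤) :
    Submodule.span K (Set.range fun g => t (r g)) = ⊤ := by
  rw [eq_top_iff, ← hspan, Submodule.span_le]
  rintro _ ⟨b, rfl⟩
  have hb : b ∈ Submodule.span R (Set.range r) := hr ▸ trivial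
  induction hb using Submodule.span_induction with
  | mem x hx => obtain ⟨g, rfl⟩ := hx; exact Submodule.subset_span ⟨g, rfl⟩
  | zero => simp
  | add x y _ _ hx hy => rw [map_add]; exact add_mem hx hy
  | smul c x _ hx =>
    rw [map_smul_of_extends_embedding ht]
    exact Submodule.smul_mem _ _ hx

/-- The Galois group acts transitively on the embeddings of an algebraic extension. -/
theorem exists_algEquiv_comp_eq [Normal R K] (ι ι' : E →ₐ[R] K) :
    ∃ σ : K ≃ₐ[R] K, ∀ e, σ (ι e) = ι' e := by
  let χ : ι.fieldRange ≃ₐ[R] ι'.fieldRange :=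
    (AlgEquiv.ofInjectiveField ι).symm.trans (AlgEquiv.ofInjectiveField ι')
  refine ⟨χ.liftNormal K, fun e => ?_⟩
  have h := χ.liftNormal_commutes K (AlgEquiv.ofInjectiveField ι e)
  have hχ : χ (AlgEquiv.ofInjectiveField ι e) = AlgEquiv.ofInjectiveField ι' e :=
    congrArg (AlgEquiv.ofInjectiveField ι')
      ((AlgEquiv.ofInjectiveField ι).symm_apply_apply e)
  rw [hχ] at h
  exact h

end

/-- The intertwining map from a module to a sum of copies of an absolutely irreducible
representation, obtained by extending scalars along an embedding. -/
theorem exists_intertwiner_blockDiagonal {R K E B V : Type*} [Field R] [Field K] [Field E]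
    [Algebra R K] [Algebra R E] [Ring B] [Algebra R B] [Algebra E B] [IsScalarTower R E B]
    [AddCommGroup V] [Module R V] [Module E V] [Module B V] [IsScalarTower R E V]
    [IsScalarTower E B V] {d m q : ℕ} (v : Basis (Fin q) E V) (ι : E →ₐ[R] K)
    (t : B →+* Matrix (Fin d) (Fin d) K)
    (hL : ∀ ψ : B →+* Matrix (Fin q) (Fin q) K,
      (∀ e, ψ (algebraMap E B e) = Matrix.scalar (Fin q) (ι e)) →
        ∃ L : (Fin q → K) ≃ₗ[K] (Fin d × Fin m → K), ∀ b v,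
          L (ψ b *ᵥ v) = Matrix.blockDiagonal (fun _ : Fin m => t b) *ᵥ L v) :
    ∃ L : (Fin q → K) ≃ₗ[K] (Fin d × Fin m → K), ∀ b x,
      L (fun l => ι (v.repr (b • x) l)) =
        Matrix.blockDiagonal (fun _ : Fin m => t b) *ᵥ L (fun l => ι (v.repr x l)) := by
  let ψ : B →+* Matrix (Fin q) (Fin q) K :=
    ι.toRingHom.mapMatrix.comp
      ((LinearMap.toMatrixAlgEquiv v).toRingEquiv.toRingHom.comp (Algebra.lsmul E E V).toRingHom)
  have hψ (b : B) : ψ b = (LinearMap.toMatrix v v (Algebra.lsmul E E V b)).map ι := rfl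
  obtain ⟨L, hL⟩ := hL ψ fun e => by
    have : Algebra.lsmul E E V (algebraMap E B e) = e • LinearMap.id := by ext x; simp
    rw [hψ, this, map_smul, LinearMap.toMatrix_id]
    ext i j
    simp [Matrix.one_apply, Matrix.diagonal_apply, apply_ite ι]
  refine ⟨L, fun b x => ?_⟩
  rw [← hL, hψ]
  congr 1
  ext l
  have h := congrFun (LinearMap.toMatrix_mulVec_repr v v (Algebra.lsmul E E V b) x) l
  rw [Algebra.lsmul_coe] at h
  rw [← h]
  simp [Matrix.mulVec, dotProduct]

/-- A matrix representation over `R` commuting with `E` is conjugate to the block sum of the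
representations obtained from it by extending scalars along distinct embeddings of `E`. -/
theorem exists_conj_blockDiagonal {R K E B : Type*} [Field R] [Field K] [Field E]
    [Algebra R K] [Algebra R E] [Ring B] [Algebra R B] [Algebra E B] [IsScalarTower R E B]
    {N d n m q : ℕ} [Module E (Fin N → R)] [Module B (Fin N → R)] [IsScalarTower R E (Fin N → R)]
    [IsScalarTower E B (Fin N → R)] (hN : N = m * n * d) (v : Basis (Fin q) E (Fin N → R))
    (ι : Fin n → E →ₐ[R] K) (hι : Function.Injective ι)
    (t : Fin n → B →+* Matrix (Fin d) (Fin d) K)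
    (L : Fin n → (Fin q → K) ≃ₗ[K] (Fin d × Fin m → K))
    (hL : ∀ k b x, L k (fun l => ι k (v.repr (b • x) l)) =
        Matrix.blockDiagonal (fun _ : Fin m => t k b) *ᵥ L k (fun l => ι k (v.repr x l))) :
    ∃ (e : (Fin d × (Fin n × Fin m)) ≃ Fin N) (P : (Matrix (Fin N) (Fin N) K)ˣ),
      ∀ (M : Matrix (Fin N) (Fin N) R) (b : B), (∀ x, b • x = M *ᵥ x) →
        P.val * M.map (algebraMap R K) * (P⁻¹).val =
          Matrix.reindex e e (Matrix.blockDiagonal fun ki : Fin n × Fin m => t ki.1 b) := by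
  classical
  let T (k : Fin n) : (Fin N → R) →+ (Fin d × Fin m → K) :=
    { toFun := fun x => L k (fun l => ι k (v.repr x l))
      map_zero' := by
        convert (L k).map_zero
        simp
      map_add' := fun x y => by
        rw [← map_add]
        congr 1
        ext l
        simp }
  have hT (k x) : T k x = L k (fun l => ι k (v.repr x l)) := rfl
  have hTsmul (k) (c : R) (x) : T k (c • x) = algebraMap R K c • T k x := by
    rw [hT, hT, ← map_smul]
    congr 1
    ext l
    rw [← algebraMap_smul E c x, map_smul, Finsupp.smul_apply, smul_eq_mul, map_mul, (ι k).commutes]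
    rfl
  let e : (Fin d × (Fin n × Fin m)) ≃ Fin N :=
    Fintype.equivFinOfCardEq (by simp [hN]; ring)
  let P' : Matrix (Fin d × (Fin n × Fin m)) (Fin N) K :=
    Matrix.of fun p x => T p.2.1 (Pi.single x 1) (p.1, p.2.2)
  have hP' (p) (x : Fin N → R) : ∑ y, P' p y * algebraMap R K (x y) = T p.2.1 x (p.1, p.2.2) := by
    conv_rhs => rw [pi_eq_sum_univ' x, map_sum, Finset.sum_apply]
    refine Finset.sum_congr rfl fun y _ => ?_
    rw [hTsmul, Pi.smul_apply, smul_eq_mul, mul_comm]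
    congr
  have hli : LinearIndependent K P'.row := by
    rw [Fintype.linearIndependent_iff]
    intro c hc
    let μ (k : Fin n) : (Fin q → K) →ₗ[K] K :=
      ∑ i, ∑ j, c (i, k, j) • (LinearMap.proj (i, j)).comp (L k).toLinearMap
    have h1 (x : Fin N → R) : ∑ k, μ k (fun l => ι k (v.repr x l)) = 0 := by
      have h := congrArg (fun u => u ⬝ᵥ fun y => algebraMap R K (x y)) hc
      simp only [sum_dotProduct, smul_dotProduct, zero_dotProduct] at h
      rw [← h, Fintype.sum_prod_type]
      simp only [Fintype.sum_prod_type, μ, LinearMap.sum_apply]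
      rw [Finset.sum_comm]
      refine Finset.sum_congr rfl fun i _ => Finset.sum_congr rfl fun k _ =>
        Finset.sum_congr rfl fun j _ => ?_
      exact congrArg (c (i, k, j) • ·) (hP' (i, k, j) x).symm
    have h2 (k l) : μ k (Pi.single l 1) = 0 := by
      have hind := (linearIndependent_toLinearMap R E K).comp ι hι
      refine Fintype.linearIndependent_iff.1 hind (fun k => μ k (Pi.single l 1)) ?_ k
      ext a
      rw [LinearMap.zero_apply, ← h1 (a • v l), LinearMap.sum_apply]
      refine Finset.sum_congr rfl fun k _ => ?_
      have : (fun l' => ι k (v.repr (a • v l) l')) = ι k a • (Pi.single l 1 : Fin q → K) := by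
        ext l'
        simp [Finsupp.single_apply, Pi.single_apply, eq_comm, apply_ite (ι k)]
      rw [this, map_smul, smul_eq_mul, mul_comm]
      rfl
    have h3 (k) : μ k = 0 := by
      refine (Pi.basisFun K (Fin q)).ext fun l => ?_
      simpa using h2 k l
    rintro ⟨i, k, j⟩
    have := LinearMap.congr_fun (h3 k) ((L k).symm (Pi.single (i, j) 1))
    simp only [μ, LinearMap.sum_apply, LinearMap.smul_apply, LinearMap.comp_apply,
      LinearEquiv.coe_coe, LinearEquiv.apply_symm_apply, LinearMap.proj_apply, Pi.single_apply,
      LinearMap.zero_apply, Prod.mk.injEq, smul_eq_mul, mul_ite, mul_one, mul_zero, ite_and] at this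
    simpa using this
  have hunit : IsUnit (P'.submatrix e.symm id) := by
    rw [← Matrix.linearIndependent_rows_iff_isUnit]
    exact hli.comp _ e.symm.injective
  refine ⟨e, hunit.unit, fun M b hM => ?_⟩
  rw [Units.mul_inv_eq_iff_eq_mul]
  have key : P' * M.map (algebraMap R K) =
      Matrix.blockDiagonal (fun ki : Fin n × Fin m => t ki.1 b) * P' := by
    ext ⟨i, k, j⟩ y
    have h1 : (P' * M.map (algebraMap R K)) (i, k, j) y = T k (b • Pi.single y 1) (i, j) := by
      rw [hM, Matrix.mulVec_single_one, ← hP' (i, k, j)]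
      rfl
    rw [h1, hT, hL, ← hT]
    simp only [Matrix.mulVec, dotProduct, Matrix.mul_apply, Fintype.sum_prod_type,
      Matrix.blockDiagonal_apply, Prod.mk.injEq, ite_and, ite_mul, zero_mul]
    simp [P']
  change P'.submatrix e.symm id * M.map (algebraMap R K) =
    Matrix.reindex e e _ * P'.submatrix e.symm id
  rw [Matrix.reindex_apply, Matrix.submatrix_mul_equiv, ← key]
  rfl

/-- Decomposition over the algebraic closure of a representation whose enveloping algebra `B` is
central simple over an extension `E` of `R`. -/
theorem exists_decomposition_of_centralSimple {R G E B : Type*} [Field R] [PerfectField R] [Group G]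
    {N : ℕ} (ρ : G →* (Matrix (Fin N) (Fin N) R)ˣ) [Field E] [Algebra R E] [FiniteDimensional R E]
    [Ring B] [Algebra R B] [Algebra E B] [IsScalarTower R E B] [Algebra.IsCentral E B]
    [IsSimpleRing B] [FiniteDimensional E B] [Module E (Fin N → R)] [Module B (Fin N → R)]
    [IsScalarTower R E (Fin N → R)] [IsScalarTower E B (Fin N → R)] (r : G →* B)
    (hr : Submodule.span R (Set.range r) = ⊤) (hrρ : ∀ g x, r g • x = (ρ g).val *ᵥ x)
    {n m d : ℕ} (hn : n = finrank R E) (hd : finrank E B = d ^ 2) (hd0 : 0 < d)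
    (hV : finrank E (Fin N → R) = m * d) (hN : N = m * n * d) :
    ∃ τ : Fin n → (G →* (Matrix (Fin d) (Fin d) (AlgebraicClosure R))ˣ),
      (∀ k : Fin n, Submodule.span (AlgebraicClosure R)
        (Set.range fun g : G => (τ k g).val) = ⊤) ∧
      (∀ k k' : Fin n, k ≠ k' →
        ¬ ∃ Q : (Matrix (Fin d) (Fin d) (AlgebraicClosure R))ˣ,
          ∀ g : G, (τ k g).val = Q.val * (τ k' g).val * (Q⁻¹).val) ∧
      (∃ (e : (Fin d × (Fin n × Fin m)) ≃ Fin N)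
          (P : (Matrix (Fin N) (Fin N) (AlgebraicClosure R))ˣ),
        ∀ g : G,
          P.val * ((ρ g).val.map (algebraMap R (AlgebraicClosure R))) * (P⁻¹).val
            = Matrix.reindex e e
                (Matrix.blockDiagonal fun ki : Fin n × Fin m => (τ ki.1 g).val)) ∧
      (∀ σ : AlgebraicClosure R ≃ₐ[R] AlgebraicClosure R, ∀ k : Fin n,
        ∃! k' : Fin n, ∃ Q : (Matrix (Fin d) (Fin d) (AlgebraicClosure R))ˣ,
          ∀ g : G, (τ k g).val.map σ = Q.val * (τ k' g).val * (Q⁻¹).val) ∧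
      (∀ k k' : Fin n, ∃ (σ : AlgebraicClosure R ≃ₐ[R] AlgebraicClosure R)
          (Q : (Matrix (Fin d) (Fin d) (AlgebraicClosure R))ˣ),
        ∀ g : G, (τ k g).val.map σ = Q.val * (τ k' g).val * (Q⁻¹).val) := by
  classical
  let ε : Fin n ≃ (E →ₐ[R] AlgebraicClosure R) :=
    (Fintype.equivFinOfCardEq ((AlgHom.card R E (AlgebraicClosure R)).trans hn.symm)).symm
  choose t ht hspan hdec using fun k =>
    exists_absolutelyIrreducible_extending (B := B) hd (ε k).toRingHom
  let τ (k : Fin n) : G →* (Matrix (Fin d) (Fin d) (AlgebraicClosure R))ˣ :=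
    MonoidHom.toHomUnits ((t k).toMonoidHom.comp r)
  have hτ (k g) : (τ k g).val = t k (r g) := rfl
  have : Module.Finite E (Fin N → R) := Module.Finite.of_restrictScalars_finite R E _
  have hne (k k' : Fin n) (Q : (Matrix (Fin d) (Fin d) (AlgebraicClosure R))ˣ)
      (hQ : ∀ g : G, (τ k g).val = Q.val * (τ k' g).val * (Q⁻¹).val) : k = k' :=
    ε.injective (embedding_eq_of_conj hr hd0 (ht k) (ht k') Q hQ)
  have hgal (σ : AlgebraicClosure R ≃ₐ[R] AlgebraicClosure R) (k k' : Fin n)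
      (h : ∀ e, σ (ε k e) = ε k' e) : ∃ Q : (Matrix (Fin d) (Fin d) (AlgebraicClosure R))ˣ,
        ∀ g : G, (τ k g).val.map σ = Q.val * (τ k' g).val * (Q⁻¹).val := by
    obtain ⟨L, hL⟩ := hdec k' 1 d (one_mul d).symm
      ((σ : AlgebraicClosure R →+* AlgebraicClosure R).mapMatrix.comp (t k)) fun e => by
        have h' : (ε k').toRingHom e = σ ((ε k).toRingHom e) := (h e).symm
        rw [RingHom.comp_apply, ht, h']
        ext i j
        simp [Matrix.diagonal_apply, apply_ite σ]
    obtain ⟨Q, hQ⟩ := exists_units_conj_of_linearEquiv L hL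
    exact ⟨Q, fun g => hQ (r g)⟩
  refine ⟨τ, fun k => span_range_comp_eq_top hr (ht k) (hspan k),
    fun k k' hk ⟨Q, hQ⟩ => hk (hne k k' Q hQ), ?_, fun σ k => ?_, fun k k' => ?_⟩
  · let v := finBasisOfFinrankEq E (Fin N → R) hV
    choose L hL using fun k =>
      exists_intertwiner_blockDiagonal v (ε k) (t k) (hdec k m (m * d) rfl)
    obtain ⟨e, P, hP⟩ := exists_conj_blockDiagonal hN v ε ε.injective t L hL
    exact ⟨e, P, fun g => hP _ (r g) (hrρ g)⟩
  · let k' := ε.symm (σ.toAlgHom.comp (ε k))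
    obtain ⟨Q, hQ⟩ := hgal σ k k' fun e => by simp [k']
    refine ⟨k', ⟨Q, hQ⟩, fun k'' ⟨Q', hQ'⟩ => ?_⟩
    refine hne k'' k' (Q'⁻¹ * Q) fun g => ?_
    have h := (hQ' g).symm.trans (hQ g)
    rw [Units.mul_inv_eq_iff_eq_mul, ← Units.eq_inv_mul_iff_mul_eq] at h
    rw [h]
    simp [mul_assoc]
  · obtain ⟨σ, hσ⟩ := exists_algEquiv_comp_eq (ε k) (ε k')
    exact ⟨σ, hgal σ k k' hσ⟩

/-- The enveloping algebra of a monoid of endomorphisms. -/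
abbrev envelopingAlgebra {R G V : Type*} [Field R] [Monoid G] [AddCommGroup V] [Module R V]
    (f : G →* Module.End R V) : Subalgebra R (Module.End R V) :=
  Algebra.adjoin R (Set.range f)

section

variable {R G V : Type*} [Field R] [Monoid G] [AddCommGroup V] [Module R V]
  (f : G →* Module.End R V)

/-- The enveloping algebra contains the monoid. -/
def toEnvelopingAlgebra : G →* envelopingAlgebra f :=
  f.codRestrict (envelopingAlgebra f) fun g => Algebra.subset_adjoin ⟨g, rfl⟩

theorem span_range_toEnvelopingAlgebra :
    Submodule.span R (Set.range (toEnvelopingAlgebra f)) = ⊤ := by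
  have h : Submodule.span R (Set.range f) = Subalgebra.toSubmodule (envelopingAlgebra f) := by
    rw [Algebra.adjoin_eq_span, ← MonoidHom.coe_mrange, Submonoid.closure_eq]
  apply Submodule.map_injective_of_injective (f := (envelopingAlgebra f).val.toLinearMap)
    Subtype.val_injective
  rw [Submodule.map_span, ← Set.range_comp, Submodule.map_top]
  change Submodule.span R (Set.range f) = _
  rw [h]
  ext x
  simp

theorem isSimpleModule_envelopingAlgebra [Nontrivial V]
    (hf : ∀ W : Submodule R V, (∀ g, ∀ v ∈ W, f g v ∈ W) → W = ⊥ ∨ W = ⊤) :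
    IsSimpleModule (envelopingAlgebra f) V := by
  have : IsSimpleOrder (Submodule (envelopingAlgebra f) V) :=
    { eq_bot_or_eq_top := fun W => by
        rcases hf (W.restrictScalars R) fun g v hv => W.smul_mem (toEnvelopingAlgebra f g) hv with
          h | h
        · left; simpa using h
        · right; simpa using h }
  exact { toIsSimpleOrder := this }

/-- The representation on `V` as endomorphisms of `V` over the commutant. -/
def toBicommutant : G →* Module.End (Module.End (envelopingAlgebra f) V) V :=
  (Module.toModuleEnd (Module.End (envelopingAlgebra f) V) (S := envelopingAlgebra f) V :
    _ →* _).comp (toEnvelopingAlgebra f)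

theorem span_range_toBicommutant [IsSimpleModule (envelopingAlgebra f) V]
    [FiniteDimensional R V] : Submodule.span R (Set.range (toBicommutant f)) = ⊤ := by
  have : Module.Finite (Module.End (envelopingAlgebra f) V) V :=
    Module.Finite.of_restrictScalars_finite R _ _
  rw [eq_top_iff]
  rintro b -
  obtain ⟨a, rfl⟩ := Module.Finite.toModuleEnd_moduleEnd_surjective (R := envelopingAlgebra f) b
  have ha : a ∈ Submodule.span R (Set.range (toEnvelopingAlgebra f)) :=
    span_range_toEnvelopingAlgebra f ▸ trivial
  induction ha using Submodule.span_induction with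
  | mem x hx => obtain ⟨g, rfl⟩ := hx; exact Submodule.subset_span ⟨g, rfl⟩
  | zero => rw [map_zero]; exact zero_mem _
  | add x y _ _ hx hy => rw [map_add]; exact add_mem hx hy
  | smul c x _ hx =>
    have : Module.toModuleEnd (Module.End (envelopingAlgebra f) V) V (c • x) =
      c • Module.toModuleEnd (Module.End (envelopingAlgebra f) V) V x := by ext v; simp
    rw [this]
    exact Submodule.smul_mem _ _ hx

end

/-- The action of `G` on column vectors. -/
def columnAction {R G : Type*} [Field R] [Group G] {N : ℕ}
    (ρ : G →* (Matrix (Fin N) (Fin N) R)ˣ) : G →* Module.End R (Fin N → R) :=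
  (Matrix.toLinAlgEquiv' (R := R) (n := Fin N) : _ →* _).comp ((Units.coeHom _).comp ρ)

theorem columnAction_apply {R G : Type*} [Field R] [Group G] {N : ℕ}
    (ρ : G →* (Matrix (Fin N) (Fin N) R)ˣ) (g : G) (v : Fin N → R) :
    columnAction ρ g v = (ρ g).val *ᵥ v := by
  simp [columnAction]

/-- A matrix in the commutant, as an endomorphism over the enveloping algebra. -/
noncomputable def repCommutantHom {R G : Type*} [Field R] [Group G] {N : ℕ}
    (ρ : G →* (Matrix (Fin N) (Fin N) R)ˣ) :
    repCommutant R G N ρ →ₐ[R] Module.End (envelopingAlgebra (columnAction ρ)) (Fin N → R) where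
  toFun M :=
    { toFun := fun v => M.val *ᵥ v
      map_add' := Matrix.mulVec_add _
      map_smul' := fun a v => by
        have ha : a ∈ Submodule.span R (Set.range (toEnvelopingAlgebra (columnAction ρ))) :=
          span_range_toEnvelopingAlgebra (columnAction ρ) ▸ trivial
        induction ha using Submodule.span_induction with
        | mem x hx =>
          obtain ⟨g, rfl⟩ := hx
          change M.val *ᵥ columnAction ρ g v = columnAction ρ g (M.val *ᵥ v)
          have h : (ρ g).val * M.val = M.val * (ρ g).val :=
            Subalgebra.mem_centralizer_iff R |>.1 M.2 _ ⟨g, rfl⟩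
          rw [columnAction_apply, columnAction_apply, Matrix.mulVec_mulVec, Matrix.mulVec_mulVec, h]
        | zero => simp
        | add x y _ _ hx hy =>
          simp only [RingHom.id_apply] at hx hy ⊢
          rw [add_smul, add_smul, Matrix.mulVec_add, hx, hy]
        | smul c x _ hx =>
          simp only [RingHom.id_apply] at hx ⊢
          rw [smul_assoc, smul_assoc, Matrix.mulVec_smul, hx] }
  map_one' := by ext; simp
  map_mul' M M' := by ext; simp
  map_zero' := by ext; simp
  map_add' M M' := by ext; simp [Matrix.add_mulVec]
  commutes' c := by
    ext v
    simp [Algebra.algebraMap_eq_smul_one, Matrix.smul_mulVec]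

theorem repCommutantHom_bijective {R G : Type*} [Field R] [Group G] {N : ℕ}
    (ρ : G →* (Matrix (Fin N) (Fin N) R)ˣ) : Function.Bijective (repCommutantHom ρ) := by
  refine ⟨fun M M' h => ?_, fun φ => ?_⟩
  · exact Subtype.ext (Matrix.toLin'.injective (LinearMap.ext fun v => LinearMap.congr_fun h v))
  · let M := LinearMap.toMatrix' (φ.restrictScalars R)
    have hM (v) : M *ᵥ v = φ v := by
      simp [M, ← Matrix.toLin'_apply]
    refine ⟨⟨M, Subalgebra.mem_centralizer_iff R |>.2 ?_⟩, LinearMap.ext hM⟩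
    rintro _ ⟨g, rfl⟩
    apply Matrix.toLin'.injective
    refine LinearMap.ext fun v => ?_
    simp only [Matrix.toLin'_apply, ← Matrix.mulVec_mulVec, hM]
    have h := φ.map_smul (toEnvelopingAlgebra (columnAction ρ) g) v
    change φ (columnAction ρ g v) = columnAction ρ g (φ v) at h
    rw [columnAction_apply, columnAction_apply] at h
    exact h.symm

/-- The centre of an algebra isomorphic to a division ring is a field. -/
theorem isField_center_of_algEquiv {R C D : Type*} [Field R] [Ring C] [Algebra R C]
    [DivisionRing D] [Algebra R D] (φ : C ≃ₐ[R] D) : IsField (Subalgebra.center R C) := by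
  have : Nontrivial C := φ.toEquiv.nontrivial
  refine ⟨⟨0, 1, zero_ne_one⟩, mul_comm, fun {a} ha => ?_⟩
  have ha' : φ a ≠ 0 := by simpa using ha
  have h1 : (a : C) * φ.symm (φ a)⁻¹ = 1 := φ.injective (by simp [ha'])
  have h2 : φ.symm (φ a)⁻¹ * (a : C) = 1 := φ.injective (by simp [ha'])
  refine ⟨⟨φ.symm (φ a)⁻¹, Subalgebra.mem_center_iff.2 fun b => ?_⟩, Subtype.ext h1⟩
  have h := Subalgebra.mem_center_iff.1 a.2 b
  calc b * φ.symm (φ a)⁻¹ = φ.symm (φ a)⁻¹ * a * b * φ.symm (φ a)⁻¹ := by rw [h2, one_mul]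
    _ = φ.symm (φ a)⁻¹ * (b * a) * φ.symm (φ a)⁻¹ := by rw [h, mul_assoc _ (a : C)]
    _ = φ.symm (φ a)⁻¹ * b := by rw [mul_assoc, mul_assoc, h1, mul_one]

/-- A division algebra is central over the centre of any isomorphic algebra. -/
theorem exists_field_isCentral.{u, v, w} {R : Type u} {C : Type v} {D : Type w} [Field R]
    [Ring C] [Algebra R C] [DivisionRing D] [Algebra R D] (φ : C ≃ₐ[R] D) :
    ∃ (E : Type v) (_ : Field E) (_ : Algebra R E) (_ : Algebra E D),
      IsScalarTower R E D ∧ Algebra.IsCentral E D ∧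
      finrank R E = finrank R (Subalgebra.center R C) ∧
      finrank E D = finrank (Subalgebra.center R C) C := by
  let iD : Subalgebra.center R C →+* D :=
    φ.toRingEquiv.toRingHom.comp (Subalgebra.center R C).val.toRingHom
  have hcomm (e x) : iD e * x = x * iD e := by
    apply φ.symm.injective
    simpa [iD] using (Subalgebra.mem_center_iff.1 e.2 (φ.symm x)).symm
  let aD : Algebra (Subalgebra.center R C) D := iD.toAlgebra' hcomm
  let φ' : C ≃ₗ[Subalgebra.center R C] D :=
    { φ.toAddEquiv with map_smul' := fun e x => map_mul φ (e : C) x }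
  let fE : Field (Subalgebra.center R C) := (isField_center_of_algEquiv φ).toField
  let aE : Algebra R (Subalgebra.center R C) := inferInstance
  refine ⟨Subalgebra.center R C, fE, aE, aD, .of_algebraMap_eq fun c => (φ.commutes c).symm,
    ⟨fun x hx => ?_⟩, rfl, φ'.finrank_eq.symm⟩
  · rw [Subalgebra.mem_center_iff] at hx
    refine Algebra.mem_bot.2 ⟨⟨φ.symm x, Subalgebra.mem_center_iff.2 fun b => ?_⟩,
      φ.apply_symm_apply x⟩
    apply φ.injective
    simpa using hx (φ b)

/-- Decomposition over the algebraic closure of a representation generating the endomorphisms of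
`R ^ N` over a division algebra `D` with centre `E`. -/
theorem exists_decomposition_of_commutant {R G E D : Type*} [Field R] [PerfectField R] [Group G]
    {N : ℕ} (ρ : G →* (Matrix (Fin N) (Fin N) R)ˣ) [Field E] [Algebra R E]
    [DivisionRing D] [Algebra R D] [Algebra E D] [IsScalarTower R E D] [Algebra.IsCentral E D]
    [FiniteDimensional R D] [Module D (Fin N → R)] [IsScalarTower R D (Fin N → R)]
    [SMulCommClass D R (Fin N → R)] (r : G →* Module.End D (Fin N → R))
    (hr : Submodule.span R (Set.range r) = ⊤) (hrρ : ∀ g x, r g x = (ρ g).val *ᵥ x)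
    {n m : ℕ} (hn : n = finrank R E) (hm : m ^ 2 = finrank E D) (hN0 : 0 < N) :
    ∃ d : ℕ, 1 ≤ d ∧ N = m * n * d ∧
      ∃ τ : Fin n → (G →* (Matrix (Fin d) (Fin d) (AlgebraicClosure R))ˣ),
        (∀ k : Fin n, Submodule.span (AlgebraicClosure R)
          (Set.range fun g : G => (τ k g).val) = ⊤) ∧
        (∀ k k' : Fin n, k ≠ k' →
          ¬ ∃ Q : (Matrix (Fin d) (Fin d) (AlgebraicClosure R))ˣ,
            ∀ g : G, (τ k g).val = Q.val * (τ k' g).val * (Q⁻¹).val) ∧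
        (∃ (e : (Fin d × (Fin n × Fin m)) ≃ Fin N)
            (P : (Matrix (Fin N) (Fin N) (AlgebraicClosure R))ˣ),
          ∀ g : G,
            P.val * ((ρ g).val.map (algebraMap R (AlgebraicClosure R))) * (P⁻¹).val
              = Matrix.reindex e e
                  (Matrix.blockDiagonal fun ki : Fin n × Fin m => (τ ki.1 g).val)) ∧
        (∀ σ : AlgebraicClosure R ≃ₐ[R] AlgebraicClosure R, ∀ k : Fin n,
          ∃! k' : Fin n, ∃ Q : (Matrix (Fin d) (Fin d) (AlgebraicClosure R))ˣ,
            ∀ g : G, (τ k g).val.map σ = Q.val * (τ k' g).val * (Q⁻¹).val) ∧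
        (∀ k k' : Fin n, ∃ (σ : AlgebraicClosure R ≃ₐ[R] AlgebraicClosure R)
            (Q : (Matrix (Fin d) (Fin d) (AlgebraicClosure R))ˣ),
          ∀ g : G, (τ k g).val.map σ = Q.val * (τ k' g).val * (Q⁻¹).val) := by
  have : NeZero N := ⟨hN0.ne'⟩
  have : FiniteDimensional R E := .of_injective
    (IsScalarTower.toAlgHom R E D).toLinearMap (algebraMap E D).injective
  have : FiniteDimensional E D := Module.Finite.of_restrictScalars_finite R E D
  have : Module.Finite D (Fin N → R) := Module.Finite.of_restrictScalars_finite R D _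
  let : Module E (Fin N → R) := Module.compHom _ (algebraMap E D)
  have : IsScalarTower E D (Fin N → R) := .of_algebraMap_smul fun _ _ => rfl
  have : IsScalarTower R E (Fin N → R) := .of_algebraMap_smul fun c x => by
    rw [← algebraMap_smul D (algebraMap R E c) x, ← IsScalarTower.algebraMap_apply R E D,
      algebraMap_smul]
  have : SMulCommClass D E (Fin N → R) := ⟨fun a e x => by
    rw [← algebraMap_smul D e x, ← algebraMap_smul D e (a • x), smul_smul, smul_smul,
      Algebra.commutes]⟩
  have := isSimpleRing_end_of_divisionRing D (Fin N → R)
  obtain ⟨hV, hB⟩ := finrank_end_of_divisionRing E D (Fin N → R)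
  rw [← hm] at hV hB
  have hs : 0 < finrank D (Fin N → R) := finrank_pos
  have hm0 : 0 < m := Nat.pos_of_ne_zero fun h => by
    have := finrank_pos (R := E) (M := D)
    simp [← hm, h] at this
  have : FiniteDimensional E (Module.End D (Fin N → R)) :=
    .of_finrank_pos (by rw [hB]; positivity)
  have hN : N = m * n * (finrank D (Fin N → R) * m) := by
    have h := finrank_mul_finrank R E (Fin N → R)
    rw [hV, ← hn, finrank_fin_fun] at h
    linarith
  have : IsScalarTower R E (Module.End D (Fin N → R)) :=
    ⟨fun c e b => LinearMap.ext fun x => smul_assoc c e (b x)⟩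
  have : IsScalarTower E (Module.End D (Fin N → R)) (Fin N → R) := ⟨fun _ _ _ => rfl⟩
  exact ⟨finrank D (Fin N → R) * m, Nat.mul_pos hs hm0, hN,
    exists_decomposition_of_centralSimple ρ r hr hrρ hn (by rw [hB]; ring)
      (Nat.mul_pos hs hm0) (by rw [hV]; ring) hN⟩

end

/-- Decomposition of the scalar extension of an irreducible representation over a perfect
field `R`: if `ρ : G → GL_N(R)` has simple associated module, `D` is its commutant
(a finite-dimensional division `R`-algebra), `E` the centre of `D`, `n = dim_R E` and
`m² = dim_E D`, then `N = m·n·d` for some `d ≥ 1` and over the algebraic closure `R̄`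
the representation `ρ` is conjugate to a block diagonal representation with blocks
`τ₁, …, τ_n`, each repeated `m` times, where the `τ_k : G → GL_d(R̄)` are pairwise
non-conjugate absolutely irreducible representations on which `Gal(R̄/R)` acts simply
transitively (up to conjugacy). -/
theorem scalar_extension_decomposition
    (R : Type*) [Field R] [PerfectField R] (G : Type*) [Group G] (N : ℕ)
    (ρ : G →* (Matrix (Fin N) (Fin N) R)ˣ)
    (hsimple : ∀ W : Submodule R (Fin N → R),
      (∀ g : G, ∀ v ∈ W, (ρ g).val.mulVec v ∈ W) → W = ⊥ ∨ W = ⊤)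
    (n m : ℕ)
    (hn : n = Module.finrank R (Subalgebra.center R (repCommutant R G N ρ)))
    (hm : m ^ 2 = Module.finrank (Subalgebra.center R (repCommutant R G N ρ))
      (repCommutant R G N ρ)) :
    ∃ d : ℕ, 1 ≤ d ∧ N = m * n * d ∧
      ∃ τ : Fin n → (G →* (Matrix (Fin d) (Fin d) (AlgebraicClosure R))ˣ),
        -- each τ_k is absolutely irreducible
        (∀ k : Fin n, Submodule.span (AlgebraicClosure R)
          (Set.range fun g : G => (τ k g).val) = ⊤) ∧
        -- the τ_k are pairwise non-conjugate
        (∀ k k' : Fin n, k ≠ k' →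
          ¬ ∃ Q : (Matrix (Fin d) (Fin d) (AlgebraicClosure R))ˣ,
            ∀ g : G, (τ k g).val = Q.val * (τ k' g).val * (Q⁻¹).val) ∧
        -- ρ is conjugate over R̄ to the block diagonal representation with each block
        -- τ_k repeated m times
        (∃ (e : (Fin d × (Fin n × Fin m)) ≃ Fin N)
            (P : (Matrix (Fin N) (Fin N) (AlgebraicClosure R))ˣ),
          ∀ g : G,
            P.val * ((ρ g).val.map (algebraMap R (AlgebraicClosure R))) * (P⁻¹).val
              = Matrix.reindex e e
                  (Matrix.blockDiagonal fun ki : Fin n × Fin m => (τ ki.1 g).val)) ∧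
        -- the Galois group permutes the conjugacy classes of the τ_k ...
        (∀ σ : AlgebraicClosure R ≃ₐ[R] AlgebraicClosure R, ∀ k : Fin n,
          ∃! k' : Fin n, ∃ Q : (Matrix (Fin d) (Fin d) (AlgebraicClosure R))ˣ,
            ∀ g : G, (τ k g).val.map σ = Q.val * (τ k' g).val * (Q⁻¹).val) ∧
        -- ... transitively
        (∀ k k' : Fin n, ∃ (σ : AlgebraicClosure R ≃ₐ[R] AlgebraicClosure R)
            (Q : (Matrix (Fin d) (Fin d) (AlgebraicClosure R))ˣ),
          ∀ g : G, (τ k g).val.map σ = Q.val * (τ k' g).val * (Q⁻¹).val) := by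
  classical
  rcases Nat.eq_zero_or_pos N with rfl | hN0
  · have hC : Subsingleton (repCommutant R G 0 ρ) := inferInstance
    have hn0 : n = 0 := hn.trans Module.finrank_zero_of_subsingleton
    subst hn0
    refine ⟨1, le_rfl, by simp, fun k => k.elim0, fun k => k.elim0, fun k => k.elim0,
      ⟨Equiv.equivOfIsEmpty _ _, 1, fun g => Matrix.ext fun i => i.elim0⟩,
      fun _ k => k.elim0, fun k => k.elim0⟩
  have : NeZero N := ⟨hN0.ne'⟩
  have hA : IsSimpleModule (envelopingAlgebra (columnAction ρ)) (Fin N → R) :=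
    isSimpleModule_envelopingAlgebra _ fun W hW => hsimple W fun g v hv => by
      simpa [columnAction_apply] using hW g v hv
  let φ := AlgEquiv.ofBijective (repCommutantHom ρ) (repCommutantHom_bijective ρ)
  have : FiniteDimensional R (Module.End (envelopingAlgebra (columnAction ρ)) (Fin N → R)) :=
    Module.Finite.equiv φ.toLinearEquiv
  let : DivisionRing (Module.End (envelopingAlgebra (columnAction ρ)) (Fin N → R)) :=
    Module.End.instDivisionRing (R := envelopingAlgebra (columnAction ρ)) (M := Fin N → R)
  obtain ⟨E, _, _, _, _, _, hE, hD⟩ := exists_field_isCentral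
    (D := Module.End (envelopingAlgebra (columnAction ρ)) (Fin N → R)) φ
  rw [← hE] at hn
  rw [← hD] at hm
  exact exists_decomposition_of_commutant ρ (toBicommutant (columnAction ρ))
    (span_range_toBicommutant _) (columnAction_apply ρ) hn hm hN0
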